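/- arXiv:1707.04783 — 2 statements merged into one kernel-verified Lean document; each statement's English description precedes it below -/
import Mathlib

section
/- If k divides n−1 and k > 1, then w = n − (n−1)/k and |A ∩ {n−k, n−k+1, …, n−1}| = k − 1. -/
/-- The set `A = { ik mod n : 0 ≤ i ≤ w-1 }`. -/
def Aset (n k w : ℕ) : Finset ℕ := (Finset.range w).image (fun i => i * k % n)

/-- If `n = m * k + 1`, the inverse of `k` modulo `n` is `n - m`. -/
theorem inverse_add_eq {m k w n : ℕ} (hn : n = m * k + 1) (hk1 : 1 < k) (hw0 : 0 < w)
    (hwn : w < n) (hgcd : Nat.Coprime n k) (hwk : w * k ≡ 1 [MOD n]) : w + m = n := by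
  have h : n ∣ (w + m) * k := by
    have h1 := hwk.add_right (m * k)
    rw [← add_mul, add_comm 1, ← hn] at h1
    exact (Nat.modEq_zero_iff_dvd).1 (h1.trans (by simp [Nat.ModEq]))
  obtain ⟨c, hc⟩ := hgcd.dvd_of_dvd_mul_right h
  have hmn : m < n := by nlinarith
  have hc2 : c < 2 := by
    by_contra! hge
    nlinarith
  interval_cases c <;> omega

/-- If `n = m * k + 1`, the last `k` residues all lie in `Aset n k w`, except for `n - k`. -/
theorem Aset_inter_Ico_eq {m k w n : ℕ} (hn : n = m * k + 1) (hkn : k < n)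
    (hwn : w < n) (hgcd : Nat.Coprime n k) (hw : w + m = n) :
    Aset n k w ∩ Finset.Ico (n - k) n = Finset.Ico (n - k + 1) n := by
  ext x
  simp only [Aset, Finset.mem_inter, Finset.mem_image, Finset.mem_range, Finset.mem_Ico]
  constructor
  · rintro ⟨⟨i, hi, rfl⟩, hlow, hup⟩
    refine ⟨?_, hup⟩
    by_contra! hle
    have heq : i * k % n = n - k := by omega
    have hd : n ∣ (i + 1) * k := by
      refine ⟨i * k / n + 1, ?_⟩
      have := Nat.div_add_mod (i * k) n
      rw [add_mul, mul_add]
      omega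
    have := Nat.le_of_dvd (by omega) (hgcd.dvd_of_dvd_mul_right hd)
    omega
  · rintro ⟨hlow, hup⟩
    obtain ⟨j, hj⟩ : ∃ j, n = x + (j + 1) := ⟨n - x - 1, by omega⟩
    refine ⟨⟨(j + 1) * m, ?_, ?_⟩, by omega, hup⟩
    · have : (j + 2) * m ≤ k * m := Nat.mul_le_mul_right m (by omega)
      nlinarith
    · have : (j + 1) * m * k = x + n * j := by
        have : (j + 1) * (m * k + 1) = (j + 1) * n := by rw [hn]
        nlinarith
      rw [this, Nat.add_mul_mod_self_left, Nat.mod_eq_of_lt hup]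

theorem stmt18 (n k : ℕ) (hn : 2 ≤ n) (hkodd : Odd k) (hk0 : 0 < k) (hkn : k < n)
    (hgcd : Nat.gcd n k = 1) (w : ℕ) (hw0 : 0 < w) (hwn : w < n) (hwk : w * k ≡ 1 [MOD n])
    (hdvd : k ∣ n - 1) (hk1 : 1 < k) :
    w = n - (n - 1) / k ∧ (Aset n k w ∩ Finset.Ico (n - k) n).card = k - 1 := by
  have hm : n = (n - 1) / k * k + 1 := by
    rw [Nat.div_mul_cancel hdvd]
    omega
  have hw := inverse_add_eq hm hk1 hw0 hwn hgcd hwk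
  refine ⟨by omega, ?_⟩
  rw [Aset_inter_Ico_eq hm hkn hwn hgcd hw, Nat.card_Ico]
  omega
end

section
/- If n−k divides n+1 and 1 < k < n−1, then w = n − (n+1)/(n−k) and |A ∩ {n−k, n−k+1, …, n−1}| = k − ⌊(k+1)/(n−k)⌋; moreover, if n−k divides n−1 and 1 < k < n−1, then w = (n−1)/(n−k) and |A ∩ {n−k, n−k+1, …, n−1}| = ⌊k/(n−k)⌋. -/
theorem mul_mod_eq_of_add_eq {n k d i j : ℕ} (hkd : k + d = n) (hij : i + j = n) :
    i * k % n = j * d % n := by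
  have h : i * k ≡ j * d [ZMOD n] := by
    refine (Int.modEq_iff_dvd).2 ⟨(d : ℤ) - i, ?_⟩
    have hk : (k : ℤ) = n - d := by omega
    have hj : (j : ℤ) = n - i := by omega
    rw [hk, hj]
    ring
  exact (Int.natCast_modEq_iff.1 (by exact_mod_cast h) : i * k ≡ j * d [MOD n])

theorem eq_of_mul_modEq {n k i j : ℕ} (hgcd : Nat.gcd n k = 1) (hi : i < n) (hj : j < n)
    (h : i * k ≡ j * k [MOD n]) : i = j :=
  (Nat.ModEq.cancel_right_of_coprime hgcd h).eq_of_lt_of_lt hi hj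

theorem Aset_inter_Ico_of_mul_eq_add_one {n k d m w : ℕ} (hkd : k + d = n) (hd : 2 ≤ d)
    (hm : n + 1 = d * m) (hwm : w + m = n) (hgcd : Nat.gcd n k = 1)
    (hwk : w * k ≡ 1 [MOD n]) :
    Aset n k w ∩ Finset.Ico d n = Finset.Ico d n \ (Finset.Ico 1 m).image (· * d) := by
  have hlt : ∀ j < m, j * d < n := fun j hj => by nlinarith
  ext x
  simp only [Aset, Finset.mem_inter, Finset.mem_image, Finset.mem_range, Finset.mem_Ico,
    Finset.mem_sdiff, not_exists, not_and]
  constructor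
  · rintro ⟨⟨i, hi, rfl⟩, hx⟩
    refine ⟨hx, fun j hj hji => ?_⟩
    have h := mul_mod_eq_of_add_eq hkd (show (n - j) + j = n by omega)
    rw [hji, Nat.mod_mod] at h
    have := eq_of_mul_modEq hgcd (by omega) (by omega) h
    omega
  · rintro ⟨hx, hne⟩
    have hx' : (x * w % n) * k % n = x := by
      have h : (x * w % n) * k ≡ x [MOD n] := calc
        (x * w % n) * k ≡ x * w * k [MOD n] := (Nat.mod_modEq _ _).mul_right _
        _ = x * (w * k) := mul_assoc _ _ _
        _ ≡ x * 1 [MOD n] := hwk.mul_left _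
        _ = x := mul_one x
      exact Nat.mod_eq_of_modEq h hx.2
    refine ⟨⟨x * w % n, ?_, hx'⟩, hx⟩
    by_contra! hi
    have hin : x * w % n < n := Nat.mod_lt _ (by omega)
    have h := mul_mod_eq_of_add_eq hkd (show x * w % n + (n - x * w % n) = n by omega)
    rw [hx'] at h
    rcases (show n - x * w % n ≤ m by omega).lt_or_eq with hj | hj
    · rw [Nat.mod_eq_of_lt (hlt _ hj)] at h
      exact hne _ ⟨by omega, hj⟩ h.symm
    · rw [hj, mul_comm, ← hm, Nat.add_mod_left, Nat.mod_eq_of_lt (by omega)] at h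
      omega

theorem Aset_inter_Ico_of_mul_add_one_eq {n k d m : ℕ} (hkd : k + d = n) (hd : 2 ≤ d)
    (hm : n = d * m + 1) :
    Aset n k m ∩ Finset.Ico d n = (Finset.Ico 1 m).image (fun j => n - j * d) := by
  have hlt : ∀ j < m, j * d + d < n := fun j hj => by nlinarith
  have hmod : ∀ j, 1 ≤ j → j < m → j * k % n = n - j * d := fun j h1 hj => by
    have hjd := hlt j hj
    have hpos : 0 < j * d := Nat.mul_pos h1 (by omega)
    have h : j * k = n - j * d + n * (j - 1) := by
      zify [hjd.le, h1, (by omega : j * d ≤ n)]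
      rw [← hkd]
      push_cast
      ring
    rw [h, Nat.add_mul_mod_self_left, Nat.mod_eq_of_lt (by omega)]
  ext x
  simp only [Aset, Finset.mem_inter, Finset.mem_image, Finset.mem_range, Finset.mem_Ico]
  constructor
  · rintro ⟨⟨i, hi, rfl⟩, hx⟩
    have h1 : 1 ≤ i := by
      by_contra! h0
      obtain rfl : i = 0 := by omega
      simp at hx
      omega
    exact ⟨i, ⟨h1, hi⟩, (hmod i h1 hi).symm⟩
  · rintro ⟨j, ⟨h1, hj⟩, rfl⟩
    have hjd := hlt j hj
    have hpos : 0 < j * d := Nat.mul_pos h1 (by omega)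
    exact ⟨⟨j, hj, hmod j h1 hj⟩, by omega, by omega⟩

theorem stmt19 (n k : ℕ) (hn : 2 ≤ n) (hkodd : Odd k) (hk0 : 0 < k) (hkn : k < n)
    (hgcd : Nat.gcd n k = 1) (w : ℕ) (hw0 : 0 < w) (hwn : w < n) (hwk : w * k ≡ 1 [MOD n]) :
    ((n - k) ∣ (n + 1) → 1 < k → k < n - 1 →
      w = n - (n + 1) / (n - k) ∧
      (Aset n k w ∩ Finset.Ico (n - k) n).card = k - (k + 1) / (n - k)) ∧
    ((n - k) ∣ (n - 1) → 1 < k → k < n - 1 →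
      w = (n - 1) / (n - k) ∧
      (Aset n k w ∩ Finset.Ico (n - k) n).card = k / (n - k)) := by
  obtain ⟨d, hd⟩ : ∃ d, d = n - k := ⟨_, rfl⟩
  have hkd : k + d = n := by omega
  rw [← hd]
  refine ⟨?_, ?_⟩
  · rintro ⟨m, hm⟩ hk1 hkn1
    have hd2 : 2 ≤ d := by omega
    have hm1 : 1 < m := by
      by_contra! h
      have : d * m ≤ d * 1 := Nat.mul_le_mul_left _ h
      omega
    have hmn : m < n := by nlinarith
    have hw : w = n - m := by
      refine eq_of_mul_modEq hgcd hwn (by omega) (hwk.trans ?_)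
      have h := mul_mod_eq_of_add_eq hkd (show (n - m) + m = n by omega)
      rw [mul_comm m d, ← hm, Nat.add_mod_left] at h
      exact h.symm
    have hdiv : (k + 1) / d = m - 1 := by
      obtain ⟨p, rfl⟩ : ∃ p, m = p + 1 := ⟨m - 1, by omega⟩
      rw [Nat.mul_succ] at hm
      rw [show k + 1 = d * p by omega, Nat.mul_div_cancel_left _ (by omega),
        Nat.add_sub_cancel]
    refine ⟨by rw [hm, Nat.mul_div_cancel_left _ (by omega)]; exact hw, ?_⟩
    rw [Aset_inter_Ico_of_mul_eq_add_one hkd hd2 hm (by omega) hgcd hwk,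
      Finset.card_sdiff_of_subset, Finset.card_image_of_injective, Nat.card_Ico, Nat.card_Ico,
      hdiv]
    · omega
    · exact fun a b h => Nat.eq_of_mul_eq_mul_right (by omega) h
    · intro x hx
      simp only [Finset.mem_image, Finset.mem_Ico] at hx ⊢
      obtain ⟨j, ⟨h1, hj⟩, rfl⟩ := hx
      exact ⟨Nat.le_mul_of_pos_left _ h1, by nlinarith⟩
  · rintro ⟨m, hm⟩ hk1 hkn1
    have hd2 : 2 ≤ d := by omega
    have hm' : n = d * m + 1 := by omega
    have hm1 : 1 ≤ m := by
      by_contra! h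
      obtain rfl : m = 0 := by omega
      omega
    have hw : w = m := by
      have hmn : m < n := by nlinarith
      refine eq_of_mul_modEq hgcd hwn hmn (hwk.trans ?_)
      have h : m * k = 1 + n * (m - 1) := by
        zify [hm1]
        have hk : (k : ℤ) = n - d := by omega
        have hn' : (n : ℤ) = d * m + 1 := by exact_mod_cast hm'
        rw [hk]
        linear_combination hn'
      rw [h]
      exact (Nat.add_mul_mod_self_left 1 n (m - 1)).symm
    have hdiv : k / d = m - 1 := by
      obtain ⟨p, rfl⟩ : ∃ p, m = p + 1 := ⟨m - 1, by omega⟩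
      rw [Nat.mul_succ] at hm
      rw [show k = 1 + d * p by omega, Nat.add_mul_div_left _ _ (by omega),
        Nat.div_eq_of_lt (by omega)]
      omega
    refine ⟨by rw [hm, Nat.mul_div_cancel_left _ (by omega)]; exact hw, ?_⟩
    rw [hw, Aset_inter_Ico_of_mul_add_one_eq hkd hd2 hm', Finset.card_image_of_injOn,
      Nat.card_Ico, hdiv]
    intro a ha b hb h
    simp only [Finset.coe_Ico, Set.mem_Ico] at ha hb h
    have h1 : a * d < n := by nlinarith
    have h2 : b * d < n := by nlinarith
    exact Nat.eq_of_mul_eq_mul_right (show 0 < d by omega) (by omega)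
end
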